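/- arXiv:2005.11530 — 4 statements merged into one kernel-verified Lean document; each statement's English description precedes it below -/
import Mathlib

section
/- Fix c ∈ ℂ, an integer k ≥ 1, and integers t_1, …, t_k with t_1 + ⋯ + t_k = 0. Then there exist m ∈ ℕ and complex numbers a_0, …, a_m, depending only on (t_1,…,t_k) and c, such that for every complex vector space V, every Virasoro family (L_n)_{n∈ℤ} with central charge c on V, and every v ∈ V with L_n v = 0 for all integers n ≥ 1, one has L_{t_1} L_{t_2} ⋯ L_{t_k} v = Σ_{j=0}^{m} a_j (L_0)^j v. (Lemma B.2 of the paper: the coefficients depend only on the commutation relations, not on the representation.) -/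
/-- `L` satisfies the Virasoro relations with central charge `c`. -/
def IsVirasoroFamily (c : ℂ) {V : Type*} [AddCommGroup V] [Module ℂ V]
    (L : ℤ → Module.End ℂ V) : Prop :=
  ∀ p q : ℤ, L p * L q - L q * L p
    = ((p : ℂ) - (q : ℂ)) • L (p + q)
      + (c / 12 * ((p : ℂ) ^ 3 - (p : ℂ)) * (if p + q = 0 then 1 else 0))
          • (1 : Module.End ℂ V)

/-- The product of the modes indexed by `l` acts on all vectors annihilated by the positive modes
as a polynomial in `L 0` that depends only on `l` and the central charge. -/
def ActsAsPolynomial.{u} (c : ℂ) (l : List ℤ) : Prop :=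
  ∃ P : Polynomial ℂ, ∀ (V : Type u) [AddCommGroup V] [Module ℂ V] (L : ℤ → Module.End ℂ V),
    IsVirasoroFamily c L → ∀ v : V, (∀ n : ℤ, 1 ≤ n → L n v = 0) →
      (l.map L).prod v = Polynomial.aeval (L 0) P v

namespace ActsAsPolynomial

universe u

variable {c : ℂ}

theorem of_swap {a b : List ℤ} {p q : ℤ}
    (hswap : ActsAsPolynomial.{u} c (a ++ q :: p :: b))
    (hmerge : ActsAsPolynomial.{u} c (a ++ (p + q) :: b))
    (hdrop : p + q = 0 → ActsAsPolynomial.{u} c (a ++ b)) :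
    ActsAsPolynomial.{u} c (a ++ p :: q :: b) := by
  obtain ⟨P, hP⟩ := hswap
  obtain ⟨Q, hQ⟩ := hmerge
  obtain ⟨R, hR⟩ : ∃ R : Polynomial ℂ, p + q = 0 → ∀ (V : Type u) [AddCommGroup V] [Module ℂ V]
      (L : ℤ → Module.End ℂ V), IsVirasoroFamily c L → ∀ v : V, (∀ n : ℤ, 1 ≤ n → L n v = 0) →
      ((a ++ b).map L).prod v = Polynomial.aeval (L 0) R v := by
    by_cases h : p + q = 0
    · obtain ⟨R, hR⟩ := hdrop h
      exact ⟨R, fun _ => hR⟩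
    · exact ⟨0, fun h' => absurd h' h⟩
  refine ⟨P + ((p : ℂ) - q) • Q
    + (c / 12 * ((p : ℂ) ^ 3 - (p : ℂ)) * (if p + q = 0 then 1 else 0)) • R, ?_⟩
  intro V _ _ L hL v hv
  have hcomm := sub_eq_iff_eq_add.mp (hL p q)
  have hprod : ((a ++ p :: q :: b).map L).prod = ((a ++ q :: p :: b).map L).prod
      + ((p : ℂ) - q) • ((a ++ (p + q) :: b).map L).prod
      + (c / 12 * ((p : ℂ) ^ 3 - (p : ℂ)) * (if p + q = 0 then 1 else 0))
        • ((a ++ b).map L).prod := by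
    simp only [List.map_append, List.map_cons, List.prod_append, List.prod_cons]
    rw [← mul_assoc (L p), hcomm]
    simp only [add_mul, mul_add, smul_mul_assoc, mul_smul_comm, one_mul, mul_assoc]
    abel
  rw [hprod]
  simp only [LinearMap.add_apply, LinearMap.smul_apply, map_add, map_smul, hP V L hL v hv,
    hQ V L hL v hv]
  by_cases h : p + q = 0
  · rw [hR h V L hL v hv]
  · simp [h]

theorem of_pos_mem {n : ℕ}
    (ih : ∀ l : List ℤ, l.length < n → l.sum = 0 → ActsAsPolynomial.{u} c l)
    {p : ℤ} (hp : 1 ≤ p) (b : List ℤ) :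
    ∀ a : List ℤ, (a ++ p :: b).length = n → (a ++ p :: b).sum = 0 →
      ActsAsPolynomial.{u} c (a ++ p :: b) := by
  induction b with
  | nil =>
    intro a _ _
    refine ⟨0, fun V _ _ L _ v hv => ?_⟩
    simp [hv p hp]
  | cons q b ihb =>
    intro a hlen hsum
    simp only [List.length_append, List.length_cons, List.sum_append, List.sum_cons] at hlen hsum
    refine of_swap ?_ (ih _ ?_ ?_) fun h => ih _ ?_ ?_
    · have := ihb (a ++ [q])
      simp only [List.append_assoc, List.singleton_append, List.length_append, List.length_cons,
        List.sum_append, List.sum_cons] at this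
      exact this (by omega) (by omega)
    all_goals
      simp only [List.length_append, List.length_cons, List.sum_append, List.sum_cons]
      omega

theorem of_sum_eq_zero (c : ℂ) (l : List ℤ) (hl : l.sum = 0) : ActsAsPolynomial.{u} c l := by
  induction hn : l.length using Nat.strong_induction_on generalizing l with
  | _ n ih =>
    by_cases hpos : ∃ p ∈ l, 1 ≤ p
    · obtain ⟨p, hmem, hp⟩ := hpos
      obtain ⟨a, b, rfl⟩ := List.append_of_mem hmem
      exact of_pos_mem (fun l' hlen hsum => ih _ hlen l' hsum rfl) hp b a hn hl
    · have hnonpos : ∀ x ∈ l, x ≤ 0 := fun x hx => by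
        by_contra h
        exact hpos ⟨x, hx, by omega⟩
      have hzero : ∀ x ∈ l, x = 0 := fun x hx => by
        obtain ⟨a, b, rfl⟩ := List.append_of_mem hx
        have ha : a.sum ≤ 0 := by
          simpa using List.sum_le_card_nsmul a 0 fun y hy => hnonpos y (by simp [hy])
        have hb : b.sum ≤ 0 := by
          simpa using List.sum_le_card_nsmul b 0 fun y hy => hnonpos y (by simp [hy])
        have hx' := hnonpos x hx
        simp only [List.sum_append, List.sum_cons] at hl
        omega
      rw [List.eq_replicate_of_mem hzero]
      exact ⟨Polynomial.X ^ l.length, fun V _ _ L _ v _ => by simp⟩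

end ActsAsPolynomial


/-- Lemma B.2: for integers `t_1, …, t_k` summing to zero there are coefficients
`a_0, …, a_m`, depending only on `(t_1,…,t_k)` and the central charge `c`, such that in any
representation of the Virasoro algebra with central charge `c`, applied to any vector
annihilated by all positive modes, the product `L_{t_1} ⋯ L_{t_k}` equals `Σ_j a_j L_0^j`. -/
theorem virasoro_zero_total_weight_polynomial_in_L0
    (c : ℂ) (k : ℕ) (hk : 1 ≤ k) (t : Fin k → ℤ) (ht : ∑ i, t i = 0) :
    ∃ (m : ℕ) (a : ℕ → ℂ),
      ∀ (V : Type*) [AddCommGroup V] [Module ℂ V] (L : ℤ → Module.End ℂ V),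
        (∀ p q : ℤ, L p * L q - L q * L p
          = ((p : ℂ) - (q : ℂ)) • L (p + q)
            + (c / 12 * ((p : ℂ) ^ 3 - (p : ℂ)) * (if p + q = 0 then 1 else 0))
                • (1 : Module.End ℂ V)) →
        ∀ v : V, (∀ n : ℤ, 1 ≤ n → L n v = 0) →
          (List.ofFn fun i => L (t i)).prod v
            = ∑ j ∈ Finset.range (m + 1), a j • (L 0 ^ j) v := by
  obtain ⟨P, hP⟩ := ActsAsPolynomial.of_sum_eq_zero c (List.ofFn t) (by rw [List.sum_ofFn, ht])
  refine ⟨P.natDegree, P.coeff, fun V _ _ L hL v hv => ?_⟩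
  have h := hP V L hL v hv
  rw [List.map_ofFn, Polynomial.aeval_eq_sum_range, LinearMap.sum_apply] at h
  exact h
end

section
/- Let V be a complex vector space, Q ∈ ℂ, and (A_n)_{n∈ℤ} linear endomorphisms of V satisfying the Heisenberg commutation relations A_n A_m − A_m A_n = (n/2) δ_{n+m,0} id_V for all n, m ∈ ℤ, together with the local-annihilation property: for every x ∈ V there is N ∈ ℕ such that A_m x = 0 for all integers m ≥ N. For n ≠ 0 define L_n x := −i(n+1)Q A_n x + Σ_{m∈ℤ} A_{n−m}(A_m x), and define L_0 x := −iQ A_0 x + A_0(A_0 x) + 2 Σ_{m≥1} A_{−m}(A_m x); under the stated hypotheses all these sums have only finitely many nonzero terms, so each L_n is a well-defined linear endomorphism of V. Then (L_n)_{n∈ℤ} satisfies the Virasoro commutation relations with central charge c_L = 1 + 6Q²: for all n, m ∈ ℤ and all x ∈ V, L_n(L_m x) − L_m(L_n x) = (n−m) L_{n+m} x + (c_L/12)(n³−n) δ_{n+m,0} x. (This is the Segal–Sugawara construction, equations (3.16)–(3.19) of the paper.) -/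
namespace Heisenberg

open Finset

variable {V : Type*} [AddCommGroup V] [Module ℂ V]

/-- Commutation relations of the Heisenberg modes. -/
def Relations (A : ℤ → Module.End ℂ V) : Prop :=
  ∀ n m : ℤ, A n * A m - A m * A n
    = ((n : ℂ) / 2 * (if n + m = 0 then 1 else 0)) • (1 : Module.End ℂ V)

/-- Every vector is annihilated by all sufficiently positive modes. -/
def LocallyAnnihilating (A : ℤ → Module.End ℂ V) : Prop :=
  ∀ x : V, ∃ N : ℕ, ∀ m : ℤ, (N : ℤ) ≤ m → A m x = 0

/-- The normally ordered quadratic term `:A_{n-j} A_j:`. -/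
def normalOrder (A : ℤ → Module.End ℂ V) (n j : ℤ) : Module.End ℂ V :=
  if 0 ≤ j then A (n - j) * A j else A j * A (n - j)

variable {A : ℤ → Module.End ℂ V}

theorem LocallyAnnihilating.finite_support (hLoc : LocallyAnnihilating A) (n : ℤ) (x : V) :
    (Function.support fun j => normalOrder A n j x).Finite := by
  obtain ⟨N, hN⟩ := hLoc x
  refine (Set.finite_Ioo (min 0 (n - N) - 1) (max 0 (N : ℤ) + 1)).subset fun j hj => ?_
  by_contra hout
  apply hj
  simp only [Set.mem_Ioo, not_and_or, not_lt] at hout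
  by_cases h0 : 0 ≤ j
  · simp [normalOrder, h0, hN j (by omega)]
  · simp [normalOrder, h0, hN (n - j) (by omega)]

/-- The normally ordered sum `∑ⱼ :A_{n-j} A_j:`. -/
noncomputable def sugawara (hLoc : LocallyAnnihilating A) (n : ℤ) : Module.End ℂ V where
  toFun x := ∑ᶠ j, normalOrder A n j x
  map_add' x y := by
    simp only [map_add]
    exact finsum_add_distrib (hLoc.finite_support n x) (hLoc.finite_support n y)
  map_smul' c x := by
    simp only [map_smul, RingHom.id_apply]
    exact (smul_finsum' c (hLoc.finite_support n x)).symm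

theorem sugawara_apply (hLoc : LocallyAnnihilating A) (n : ℤ) (x : V) :
    sugawara hLoc n x = ∑ᶠ j, normalOrder A n j x := rfl

theorem sugawara_apply_of_ne_zero (hA : Relations A) (hLoc : LocallyAnnihilating A) {n : ℤ}
    (hn : n ≠ 0) (x : V) : sugawara hLoc n x = ∑ᶠ j, A (n - j) (A j x) := by
  rw [sugawara_apply]
  refine finsum_congr fun j => ?_
  by_cases h0 : 0 ≤ j
  · simp [normalOrder, h0]
  · have h := congrArg (fun f : Module.End ℂ V => f x) (hA (n - j) j)
    simp only [sub_add_cancel, hn, if_false, mul_zero, zero_smul, LinearMap.sub_apply,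
      Module.End.mul_apply, LinearMap.zero_apply, sub_eq_zero] at h
    simp [normalOrder, h0, h]

theorem sugawara_zero_apply (hLoc : LocallyAnnihilating A) (x : V) :
    sugawara hLoc 0 x
      = A 0 (A 0 x) + (2 : ℂ) • ∑ᶠ m ∈ Set.Ici (1 : ℤ), A (-m) (A m x) := by
  set f : ℤ → V := (Set.Ici (1 : ℤ)).indicator fun m => A (-m) (A m x) with hf
  have hfin : f.support.Finite := by
    refine (hLoc.finite_support 0 x).subset fun j hj => ?_
    have h1 : 1 ≤ j := by
      by_contra h1
      exact hj (by simp [hf, h1])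
    have h0 : 0 ≤ j := by omega
    simpa [hf, h1, h0, normalOrder] using hj
  have hfin' : (Function.support fun j => f (-j)).Finite :=
    hfin.preimage neg_injective.injOn
  have hsing : (Function.support (Pi.single (0 : ℤ) (A 0 (A 0 x)) : ℤ → V)).Finite :=
    (Set.finite_singleton 0).subset Pi.support_single_subset
  have hsplit : ∀ j, normalOrder A 0 j x
      = (Pi.single (0 : ℤ) (A 0 (A 0 x)) : ℤ → V) j + (f j + f (-j)) := by
    intro j
    rcases lt_trichotomy j 0 with h | rfl | h
    · have h1 : ¬ 1 ≤ j := by omega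
      have h2 : 1 ≤ -j := by omega
      simp [normalOrder, hf, h1, h2, h.not_ge, h.ne]
    · simp [normalOrder, hf]
    · have h1 : 1 ≤ j := by omega
      have h2 : ¬ 1 ≤ -j := by omega
      simp [normalOrder, hf, h1, h2, h.le, h.ne']
  have hneg : ∑ᶠ j, f (-j) = ∑ᶠ j, f j := finsum_comp_equiv (Equiv.neg ℤ)
  rw [sugawara_apply, finsum_congr hsplit, finsum_add_distrib hsing, finsum_add_distrib hfin hfin',
    hneg, finsum_eq_single _ (0 : ℤ), finsum_mem_def, two_smul]
  · simp [hf]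
  · intro j hj
    simp [hj]
  · exact (hfin.union hfin').subset (Function.support_add _ _)

theorem Relations.apply_apply (hA : Relations A) (n m : ℤ) (x : V) :
    A n (A m x) = A m (A n x) + ((n : ℂ) / 2 * (if n + m = 0 then 1 else 0)) • x := by
  rw [← sub_eq_iff_eq_add']
  exact congrArg (fun f : Module.End ℂ V => f x) (hA n m)

theorem normalOrder_commutator (hA : Relations A) (n j k : ℤ) (x : V) :
    normalOrder A n j (A k x) - A k (normalOrder A n j x)
      = ((j : ℂ) / 2 * (if j + k = 0 then 1 else 0)) • A (n - j) x
        + (((n - j : ℤ) : ℂ) / 2 * (if n - j + k = 0 then 1 else 0)) • A j x := by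
  unfold normalOrder
  split_ifs <;>
  · simp only [Module.End.mul_apply, hA.apply_apply j k, hA.apply_apply (n - j) k, map_add,
      map_smul, *, if_true, if_false]
    module

theorem sugawara_commutator (hA : Relations A) (hLoc : LocallyAnnihilating A) (n k : ℤ) (x : V) :
    sugawara hLoc n (A k x) = A k (sugawara hLoc n x) - (k : ℂ) • A (n + k) x := by
  have hfin : (Function.support fun j => A k (normalOrder A n j x)).Finite :=
    (hLoc.finite_support n x).subset fun j hj h => hj (by simp [h])
  have h1 : ∀ j, j ≠ -k →
      ((j : ℂ) / 2 * (if j + k = 0 then 1 else 0)) • A (n - j) x = 0 := by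
    intro j hj
    simp [show j + k ≠ 0 by omega]
  have h2 : ∀ j, j ≠ n + k →
      (((n - j : ℤ) : ℂ) / 2 * (if n - j + k = 0 then 1 else 0)) • A j x = 0 := by
    intro j hj
    rw [if_neg (by omega)]
    simp
  have key : sugawara hLoc n (A k x) - A k (sugawara hLoc n x) = -(k : ℂ) • A (n + k) x := by
    rw [sugawara_apply, sugawara_apply, map_finsum (A k) (hLoc.finite_support n x),
      ← finsum_sub_distrib (hLoc.finite_support n _) hfin,
      finsum_congr fun j => normalOrder_commutator hA n j k x, finsum_add_distrib,
      finsum_eq_single _ _ h1, finsum_eq_single _ _ h2]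
    · rw [if_pos (by omega), if_pos (by omega), sub_neg_eq_add]
      push_cast
      module
    · exact (Set.finite_singleton (-k)).subset fun j hj => by_contra fun h => hj (h1 j h)
    · exact (Set.finite_singleton (n + k)).subset fun j hj => by_contra fun h => hj (h2 j h)
  rw [sub_eq_iff_eq_add] at key
  rw [key]
  module

/-- The scalar produced when the `k`-th term of the shifted sum is brought to normal order. -/
noncomputable def anomaly (n k : ℤ) : ℂ :=
  (k : ℂ) * (n + k) / 2 * ((if 0 ≤ k then 1 else 0) - (if 0 ≤ n + k then 1 else 0))

theorem sum_range_mul_sub (p : ℕ) (z : ℂ) :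
    ∑ i ∈ range p, (i : ℂ) * (z - i) = z * (p * (p - 1) / 2) - (p * (p - 1) * (2 * p - 1) / 6) := by
  induction p with
  | zero => simp
  | succ p ih =>
    rw [sum_range_succ, ih]
    push_cast
    ring

theorem support_anomaly_finite (n : ℤ) : (Function.support (anomaly n)).Finite := by
  refine (Set.finite_Icc (-|n|) |n|).subset fun k hk => ?_
  by_contra hout
  apply hk
  have h : 0 ≤ k ↔ 0 ≤ n + k := by
    rw [Set.mem_Icc] at hout
    rcases abs_cases n with h | h <;> omega
  simp [anomaly, h]

theorem finsum_anomaly (n : ℤ) : ∑ᶠ k, anomaly n k = ((n : ℂ) ^ 3 - n) / 12 := by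
  obtain ⟨p, rfl | rfl⟩ := n.eq_nat_or_neg
  · rw [finsum_eq_sum_of_support_subset (s := (range p).image fun i : ℕ => (i : ℤ) - p),
      sum_image (fun a _ b _ h => by simpa using h)]
    · have h : ∀ i ∈ range p, anomaly p ((i : ℤ) - p) = (i : ℂ) * (p - i) / 2 := by
        intro i hi
        rw [mem_range] at hi
        rw [anomaly, if_neg (by omega), if_pos (by omega)]
        push_cast
        ring
      rw [sum_congr rfl h, ← sum_div, sum_range_mul_sub]
      push_cast
      ring
    · intro k hk
      simp only [coe_image, coe_range, Set.mem_image, Set.mem_Iio]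
      have h : ¬ (0 ≤ k ↔ 0 ≤ (p : ℤ) + k) := fun h => hk (by simp [anomaly, h])
      exact ⟨(k + p).toNat, by omega, by omega⟩
  · rw [finsum_eq_sum_of_support_subset (s := (range p).image fun i : ℕ => (i : ℤ)),
      sum_image (fun a _ b _ h => by simpa using h)]
    · have h : ∀ i ∈ range p, anomaly (-p) (i : ℤ) = -((i : ℂ) * (p - i) / 2) := by
        intro i hi
        rw [mem_range] at hi
        rw [anomaly, if_pos (by omega), if_neg (by omega)]
        push_cast
        ring
      rw [sum_congr rfl h, sum_neg_distrib, ← sum_div, sum_range_mul_sub]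
      push_cast
      ring
    · intro k hk
      simp only [coe_image, coe_range, Set.mem_image, Set.mem_Iio]
      have h : ¬ (0 ≤ k ↔ 0 ≤ -(p : ℤ) + k) := fun h => hk (by simp [anomaly, h])
      exact ⟨k.toNat, by omega, by omega⟩

theorem sugawara_normalOrder_commutator (hA : Relations A) (hLoc : LocallyAnnihilating A)
    (n m k : ℤ) (x : V) :
    sugawara hLoc n (normalOrder A m k x) - normalOrder A m k (sugawara hLoc n x)
      = ((k : ℂ) - m) • normalOrder A (n + m) k x
        + (-(k : ℂ) • normalOrder A (n + m) (n + k) x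
          + ((if n + m = 0 then 1 else 0) * anomaly n k) • x) := by
  have h1 : n + m - (n + k) = m - k := by ring
  have h2 : n + (m - k) = n + m - k := by ring
  have h3 := hA.apply_apply (m - k) (n + k) x
  have h4 : m - k + (n + k) = n + m := by ring
  rw [h4] at h3
  by_cases hnm : n + m = 0
  · obtain rfl : m = -n := by omega
    simp only [normalOrder, anomaly, h1]
    split_ifs <;>
    · simp only [Module.End.mul_apply, sugawara_commutator hA, map_sub, map_smul, h2, h3]
      push_cast
      simp only [hnm, if_true]
      module
  · simp only [hnm, if_false, mul_zero, zero_smul, add_zero] at h3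
    simp only [normalOrder, h1, hnm, if_false, zero_mul, zero_smul, add_zero]
    split_ifs <;>
    · simp only [Module.End.mul_apply, sugawara_commutator hA, map_sub, map_smul, h2, h3]
      push_cast
      module

theorem sugawara_virasoro (hA : Relations A) (hLoc : LocallyAnnihilating A) (n m : ℤ) (x : V) :
    sugawara hLoc n (sugawara hLoc m x) - sugawara hLoc m (sugawara hLoc n x)
      = ((n : ℂ) - m) • sugawara hLoc (n + m) x
        + ((if n + m = 0 then 1 else 0) * (((n : ℂ) ^ 3 - n) / 12)) • x := by
  have hB := hLoc.finite_support (n + m) x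
  have hT : (Function.support fun k => sugawara hLoc n (normalOrder A m k x)).Finite :=
    (hLoc.finite_support m x).subset fun j hj h => hj (by simp [h])
  have hshift : (Function.support fun k : ℤ =>
      -(k : ℂ) • normalOrder A (n + m) (n + k) x).Finite :=
    (hB.preimage (f := (n + ·)) (add_right_injective n).injOn).subset fun j hj h => hj (by
      simp only [h, smul_zero])
  have hfirst : (Function.support fun k : ℤ =>
      ((k : ℂ) - m) • normalOrder A (n + m) k x).Finite :=
    hB.subset fun j hj h => hj (by simp only [h, smul_zero])
  have hfirst' : (Function.support fun k : ℤ =>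
      ((n : ℂ) - k) • normalOrder A (n + m) k x).Finite :=
    hB.subset fun j hj h => hj (by simp only [h, smul_zero])
  have hc : (Function.support fun k =>
      (if n + m = 0 then (1 : ℂ) else 0) * anomaly n k).Finite :=
    (support_anomaly_finite n).subset fun j hj h => hj (by simp only [h, mul_zero])
  have hcx : (Function.support fun k =>
      ((if n + m = 0 then (1 : ℂ) else 0) * anomaly n k) • x).Finite :=
    hc.subset fun j hj h => hj (by simp only [h, zero_smul])
  have hreindex : ∑ᶠ k : ℤ, -(k : ℂ) • normalOrder A (n + m) (n + k) x
      = ∑ᶠ k : ℤ, ((n : ℂ) - k) • normalOrder A (n + m) k x := by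
    rw [← finsum_comp_equiv (Equiv.addLeft n)
      (f := fun k : ℤ => ((n : ℂ) - k) • normalOrder A (n + m) k x)]
    refine finsum_congr fun k => ?_
    simp
  rw [sugawara_apply hLoc m x, sugawara_apply hLoc m (sugawara hLoc n x),
    map_finsum _ (hLoc.finite_support m x),
    ← finsum_sub_distrib hT (hLoc.finite_support m _),
    finsum_congr fun k => sugawara_normalOrder_commutator hA hLoc n m k x,
    finsum_add_distrib hfirst ((hshift.union hcx).subset (Function.support_add _ _)),
    finsum_add_distrib hshift hcx, hreindex, ← add_assoc, ← finsum_add_distrib hfirst hfirst',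
    ← finsum_smul' hc, ← mul_finsum' _ _ (support_anomaly_finite n), finsum_anomaly, sugawara_apply,
    smul_finsum' _ hB]
  congr 1
  refine finsum_congr fun k => ?_
  module

end Heisenberg


/-- Segal–Sugawara construction (equations (3.16)–(3.19)): given a Heisenberg family
`(A_n)_{n∈ℤ}` with `[A_n, A_m] = (n/2) δ_{n+m,0}` such that every vector is annihilated by all
sufficiently positive modes, the operators
`L_n = −i(n+1)Q A_n + Σ_m A_{n−m} A_m` (n ≠ 0) and
`L_0 = −iQ A_0 + A_0² + 2 Σ_{m≥1} A_{−m} A_m`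
satisfy the Virasoro commutation relations with central charge `c_L = 1 + 6Q²`. -/
theorem segal_sugawara_virasoro
    (V : Type*) [AddCommGroup V] [Module ℂ V] (Q : ℂ)
    (A : ℤ → Module.End ℂ V)
    (hHeis : ∀ n m : ℤ, A n * A m - A m * A n
      = ((n : ℂ) / 2 * (if n + m = 0 then 1 else 0)) • (1 : Module.End ℂ V))
    (hLoc : ∀ x : V, ∃ N : ℕ, ∀ m : ℤ, (N : ℤ) ≤ m → A m x = 0)
    (L : ℤ → V → V)
    (hLn : ∀ n : ℤ, n ≠ 0 → ∀ x : V,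
      L n x = (-Complex.I * ((n : ℂ) + 1) * Q) • A n x + ∑ᶠ m : ℤ, A (n - m) (A m x))
    (hL0 : ∀ x : V,
      L 0 x = (-Complex.I * Q) • A 0 x + A 0 (A 0 x)
        + (2 : ℂ) • ∑ᶠ m ∈ Set.Ici (1 : ℤ), A (-m) (A m x)) :
    ∀ (n m : ℤ) (x : V),
      L n (L m x) - L m (L n x)
        = ((n : ℂ) - (m : ℂ)) • L (n + m) x
          + ((1 + 6 * Q ^ 2) / 12 * ((n : ℂ) ^ 3 - (n : ℂ))
              * (if n + m = 0 then 1 else 0)) • x := by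
  intro n m x
  have hA : Heisenberg.Relations A := hHeis
  have hAnn : Heisenberg.LocallyAnnihilating A := hLoc
  have hL : ∀ n x, L n x
      = (-Complex.I * ((n : ℂ) + 1) * Q) • A n x + Heisenberg.sugawara hAnn n x := by
    intro n x
    by_cases hn : n = 0
    · subst hn
      rw [hL0, Heisenberg.sugawara_zero_apply, add_assoc]
      simp
    · rw [hLn n hn, Heisenberg.sugawara_apply_of_ne_zero hA hAnn hn]
  have hT := sub_eq_iff_eq_add.mp (Heisenberg.sugawara_virasoro hA hAnn n m x)
  have hAA := Heisenberg.Relations.apply_apply hA n m x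
  simp only [hL, map_add, map_smul, Heisenberg.sugawara_commutator hA, hT, hAA]
  have hI : Complex.I ^ 2 = -1 := Complex.I_sq
  simp only [add_comm m n]
  by_cases hnm : n + m = 0
  · obtain rfl : m = -n := by omega
    simp only [hnm, if_true]
    push_cast
    match_scalars <;>
      first
      | ring1
      | linear_combination (((n : ℂ) - (n : ℂ) ^ 3) * Q ^ 2 / 2) * hI
  · simp only [hnm, if_false]
    push_cast
    module
end

section
/- Let z ∈ ℂ with z ∉ [0,∞) (that is, it is not the case that Im z = 0 and Re z ≥ 0). Then the function x ↦ Re( (x − z)^{1/2} ) is monotone nondecreasing on [0, ∞), where w^{1/2} denotes the principal branch of the complex square root. Equivalently (Lemma 5.3 of the paper): for the square-root branch √ characterized by Im √w > 0 for w ∉ [0,∞), the map x ∈ [0,∞) ↦ Im √(z − x) is nondecreasing. -/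
/-- Lemma 5.3: for `z ∉ [0,∞)`, the map `x ↦ Re((x − z)^{1/2})` (principal branch) is
nondecreasing on `[0, ∞)`. -/
theorem re_sqrt_sub_monotoneOn (z : ℂ) (hz : ¬ (z.im = 0 ∧ 0 ≤ z.re)) :
    MonotoneOn (fun x : ℝ => (((x : ℂ) - z) ^ ((1 : ℂ) / 2)).re) (Set.Ici (0 : ℝ)) := by
  intro x _ y _ hxy
  simp only [one_div, Complex.cpow_inv_two_re, Complex.sub_re, Complex.ofReal_re]
  have h : ‖(x : ℂ) - z‖ ≤ ‖(y : ℂ) - z‖ + (y - x) := by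
    calc ‖(x : ℂ) - z‖ = ‖((y : ℂ) - z) - ((y - x : ℝ) : ℂ)‖ := by
          congr 1; push_cast; ring
      _ ≤ ‖(y : ℂ) - z‖ + ‖((y - x : ℝ) : ℂ)‖ := norm_sub_le _ _
      _ = ‖(y : ℂ) - z‖ + (y - x) := by
          rw [Complex.norm_of_nonneg (sub_nonneg.mpr hxy)]
  apply Real.sqrt_le_sqrt
  linarith
end

section
/- Let γ ∈ (0,2), Q = 2/γ + γ/2, and λ ≥ 0. Define W := { α ∈ ℂ : Re α ≤ Q and Re( ((Q−α)² − 2λ)^{1/2} ) > Re(Q−α) − γ/2 }, where w^{1/2} is the principal branch of the complex square root. Then W is a connected subset of the half-plane {α : Re α ≤ Q}; moreover W contains the vertical line {Q + iP : P ∈ ℝ}, and W contains the real half-line (−∞, Q − 2λ/γ − γ/4). (This is the description of the analyticity region W_ℓ in Proposition 5.13 of the paper, with λ = λ_ℓ.) -/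
/-- The principal square root has nonnegative real part. -/
lemma Complex.re_cpow_one_half_nonneg (w : ℂ) : 0 ≤ (w ^ ((1 : ℂ) / 2)).re := by
  have h : ((1 : ℂ) / 2) = ((1 / 2 : ℝ) : ℂ) := by push_cast; rfl
  rw [h, Complex.cpow_ofReal_re]
  refine mul_nonneg (Real.rpow_nonneg (norm_nonneg _) _) (Real.cos_nonneg_of_mem_Icc ⟨?_, ?_⟩)
  · linarith [Complex.neg_pi_lt_arg w]
  · linarith [Complex.arg_le_pi w]

lemma Complex.cpow_one_half_sq (w : ℂ) : (w ^ ((1 : ℂ) / 2)) ^ 2 = w := by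
  have h := Complex.cpow_nat_inv_pow w (two_ne_zero (α := ℕ))
  simpa only [one_div, Nat.cast_ofNat] using h

/-- For `z = a + ib` and `s + it` the principal square root of `z² - 2l`, the quantity
`(c² + b²)(a² - c²) - 2lc²` factors as `(s² - c²)(t² + c²)`. -/
lemma exists_im_sqrt_factorization (l : ℝ) (z : ℂ) :
    ∃ t : ℝ, ((z ^ 2 - 2 * (l : ℂ)) ^ ((1 : ℂ) / 2)).re ^ 2 - t ^ 2
        = z.re ^ 2 - z.im ^ 2 - 2 * l ∧
      ∀ c : ℝ, (c ^ 2 + z.im ^ 2) * (z.re ^ 2 - c ^ 2) - 2 * l * c ^ 2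
        = (((z ^ 2 - 2 * (l : ℂ)) ^ ((1 : ℂ) / 2)).re ^ 2 - c ^ 2) * (t ^ 2 + c ^ 2) := by
  have h := Complex.cpow_one_half_sq (z ^ 2 - 2 * (l : ℂ))
  set u := (z ^ 2 - 2 * (l : ℂ)) ^ ((1 : ℂ) / 2)
  have hre := congrArg Complex.re h
  have him := congrArg Complex.im h
  simp [pow_two] at hre him
  refine ⟨u.im, by linear_combination hre, fun c => ?_⟩
  have hst : u.re * u.im = z.re * z.im := by linear_combination him / 2
  linear_combination (-(u.re * u.im) - z.re * z.im) * hst - c ^ 2 * hre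

/-- A polynomial criterion for a lower bound on the real part of the square root. -/
lemma lt_re_sqrt_of_poly_pos {l c : ℝ} {z : ℂ}
    (h : 2 * l * c ^ 2 < (c ^ 2 + z.im ^ 2) * (z.re ^ 2 - c ^ 2)) :
    c < ((z ^ 2 - 2 * (l : ℂ)) ^ ((1 : ℂ) / 2)).re := by
  obtain ⟨t, -, ht⟩ := exists_im_sqrt_factorization l z
  have hpos := ht c ▸ sub_pos.2 h
  exact lt_of_pow_lt_pow_left₀ 2 (Complex.re_cpow_one_half_nonneg _)
    (sub_pos.1 (pos_of_mul_pos_left hpos (by positivity)))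

lemma poly_pos_of_lt_re_sqrt {l c : ℝ} {z : ℂ} (hc : 0 < c)
    (h : c < ((z ^ 2 - 2 * (l : ℂ)) ^ ((1 : ℂ) / 2)).re) :
    2 * l * c ^ 2 < (c ^ 2 + z.im ^ 2) * (z.re ^ 2 - c ^ 2) := by
  obtain ⟨t, -, ht⟩ := exists_im_sqrt_factorization l z
  rw [← sub_pos, ht c]
  exact mul_pos (sub_pos.2 (pow_lt_pow_left₀ h hc.le two_ne_zero)) (by positivity)

/-- The defining inequality of the region is preserved when the imaginary part grows in absolute
value. -/
lemma lt_re_sqrt_of_abs_im_le {l g : ℝ} (hg : 0 < g) {z z' : ℂ} (hre : z'.re = z.re)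
    (him : |z.im| ≤ |z'.im|) (h : z.re - g < ((z ^ 2 - 2 * (l : ℂ)) ^ ((1 : ℂ) / 2)).re) :
    z'.re - g < ((z' ^ 2 - 2 * (l : ℂ)) ^ ((1 : ℂ) / 2)).re := by
  have hsq : z.im ^ 2 ≤ z'.im ^ 2 := sq_le_sq.2 him
  rcases lt_trichotomy z.re g with hlt | heq | hgt
  · exact lt_of_lt_of_le (by linarith) (Complex.re_cpow_one_half_nonneg _)
  · rcases eq_or_ne z'.im 0 with h0 | h0
    · have : z.im = 0 := by simpa [h0] using him
      rwa [Complex.ext hre (h0.trans this.symm)]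
    · refine lt_re_sqrt_of_poly_pos ?_
      rw [hre, heq]
      have : 0 < z'.im ^ 2 * g ^ 2 := by positivity
      linarith
  · have hp := poly_pos_of_lt_re_sqrt (sub_pos.2 hgt) h
    refine lt_re_sqrt_of_poly_pos ?_
    rw [hre]
    refine hp.trans_le (mul_le_mul_of_nonneg_right (by linarith) ?_)
    nlinarith

/-- The defining inequality of the region holds once the imaginary part is large compared to the
real part. -/
lemma lt_re_sqrt_of_large_im {l g : ℝ} (hl : 0 ≤ l) (hg : 0 < g) {z : ℂ}
    (him : 2 * l * z.re ^ 2 < z.im ^ 2 * g ^ 2) :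
    z.re - g < ((z ^ 2 - 2 * (l : ℂ)) ^ ((1 : ℂ) / 2)).re := by
  rcases lt_or_ge z.re g with hlt | hge
  · exact lt_of_lt_of_le (by linarith) (Complex.re_cpow_one_half_nonneg _)
  · refine lt_re_sqrt_of_poly_pos ?_
    have h1 : 2 * l * (z.re - g) ^ 2 ≤ 2 * l * z.re ^ 2 :=
      mul_le_mul_of_nonneg_left (pow_le_pow_left₀ (by linarith) (by linarith) 2) (by positivity)
    have h2 : g ^ 2 ≤ z.re ^ 2 - (z.re - g) ^ 2 := by nlinarith
    have h3 : z.im ^ 2 * g ^ 2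
        ≤ ((z.re - g) ^ 2 + z.im ^ 2) * (z.re ^ 2 - (z.re - g) ^ 2) :=
      mul_le_mul (by nlinarith [sq_nonneg (z.re - g)]) h2 (by positivity) (by positivity)
    linarith

/-- The defining inequality of the region holds at points far enough to the right. -/
lemma lt_re_sqrt_of_large_re {l g : ℝ} {z : ℂ} (hg : 0 < g) (h : 2 * l < g * (2 * z.re - g)) :
    z.re - g < ((z ^ 2 - 2 * (l : ℂ)) ^ ((1 : ℂ) / 2)).re := by
  have hs := Complex.re_cpow_one_half_nonneg (z ^ 2 - 2 * (l : ℂ))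
  rcases lt_trichotomy z.re g with hlt | heq | hgt
  · linarith
  · obtain ⟨t, ht, hfac⟩ := exists_im_sqrt_factorization l z
    by_contra! hle
    have h0 := le_antisymm (hle.trans_eq (sub_eq_zero.2 heq)) hs
    have hz := hfac 0
    rw [h0, heq] at hz
    rw [h0, heq] at ht
    have him : z.im ^ 2 = 0 := by
      have : z.im ^ 2 * g ^ 2 = 0 := by linarith
      exact (mul_eq_zero.1 this).resolve_right (by positivity)
    rw [heq] at h
    nlinarith [sq_nonneg t]
  · refine lt_re_sqrt_of_poly_pos ?_
    have hc : 0 < (z.re - g) ^ 2 := pow_pos (sub_pos.2 hgt) 2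
    have hd : z.re ^ 2 - (z.re - g) ^ 2 = g * (2 * z.re - g) := by ring
    have hd0 : 0 ≤ g * (2 * z.re - g) := mul_nonneg hg.le (by linarith)
    rw [hd]
    nlinarith [mul_lt_mul_of_pos_left h hc, mul_nonneg (sq_nonneg z.im) hd0]

/-- A set of complex numbers is connected if it contains the vertical line `re = q`, is stable under
increasing `|im|`, and contains the horizontal segments from the vertical line through any of its
points to the line `re = q` at all sufficiently large heights. -/
lemma isConnected_of_vertical_stable {W : Set ℂ} {q : ℝ}
    (hline : ∀ t : ℝ, (q : ℂ) + t * Complex.I ∈ W)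
    (hup : ∀ z ∈ W, ∀ t : ℝ, |z.im| ≤ |t| → (z.re : ℂ) + t * Complex.I ∈ W)
    (hhor : ∀ z ∈ W, ∃ M : ℝ, ∀ t : ℝ, M ≤ |t| →
      ∀ x ∈ Set.uIcc z.re q, (x : ℂ) + t * Complex.I ∈ W) :
    IsConnected W := by
  have hq : (q : ℂ) ∈ W := by simpa using hline 0
  refine ⟨⟨q, hq⟩, isPreconnected_of_forall (q : ℂ) fun z hz => ?_⟩
  obtain ⟨M, hM⟩ := hhor z hz
  obtain ⟨t, hMt, hzt⟩ : ∃ t : ℝ, M ≤ |t| ∧ ∀ y ∈ Set.uIcc z.im t, |z.im| ≤ |y| := by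
    rcases le_total 0 z.im with h | h
    · refine ⟨z.im + |M|, ?_, fun y hy => ?_⟩
      · rw [abs_of_nonneg (by positivity)]
        linarith [le_abs_self M]
      · rw [Set.uIcc_of_le (by linarith [abs_nonneg M])] at hy
        exact abs_le_abs_of_nonneg h hy.1
    · refine ⟨z.im - |M|, ?_, fun y hy => ?_⟩
      · rw [abs_of_nonpos (by linarith [abs_nonneg M])]
        linarith [le_abs_self M]
      · rw [Set.uIcc_of_ge (by linarith [abs_nonneg M])] at hy
        exact abs_le_abs_of_nonpos h hy.2
  let A : Set ℂ := (fun y : ℝ => (z.re : ℂ) + y * Complex.I) '' Set.uIcc z.im t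
  let B : Set ℂ := (fun x : ℝ => (x : ℂ) + t * Complex.I) '' Set.uIcc z.re q
  let C : Set ℂ := Set.range fun y : ℝ => (q : ℂ) + y * Complex.I
  have hA : IsPreconnected A :=
    isPreconnected_uIcc.image _ (Continuous.continuousOn (by fun_prop))
  have hB : IsPreconnected B :=
    isPreconnected_uIcc.image _ (Continuous.continuousOn (by fun_prop))
  have hC : IsPreconnected C := isPreconnected_range (by fun_prop)
  have hAB : IsPreconnected (A ∪ B) :=
    hA.union ((z.re : ℂ) + t * Complex.I) ⟨t, Set.right_mem_uIcc, rfl⟩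
      ⟨z.re, Set.left_mem_uIcc, rfl⟩ hB
  refine ⟨A ∪ B ∪ C, ?_, Or.inr ⟨0, by simp⟩,
    Or.inl (Or.inl ⟨z.im, Set.left_mem_uIcc, Complex.re_add_im z⟩),
    hAB.union ((q : ℂ) + t * Complex.I) (Or.inr ⟨q, Set.right_mem_uIcc, rfl⟩) ⟨t, rfl⟩ hC⟩
  rintro w ((⟨y, hy, rfl⟩ | ⟨x, hx, rfl⟩) | ⟨y, rfl⟩)
  · exact hup z hz y (hzt y hy)
  · exact hM t hMt x hx
  · exact hline y

/-- Proposition 5.13 (analyticity region `W_ℓ`): for `γ ∈ (0,2)`, `Q = 2/γ + γ/2`, `λ ≥ 0`, the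
set `W = {α : Re α ≤ Q, Re(((Q−α)² − 2λ)^{1/2}) > Re(Q−α) − γ/2}` is a connected subset of the
half-plane `{Re α ≤ Q}`, containing the vertical line `Q + iℝ` and the real half-line
`(−∞, Q − 2λ/γ − γ/4)`. -/
theorem analyticity_region_connected
    (γ : ℝ) (hγ0 : 0 < γ) (hγ2 : γ < 2) (Q : ℝ) (hQ : Q = 2 / γ + γ / 2)
    (lam : ℝ) (hlam : 0 ≤ lam) (W : Set ℂ)
    (hW : W = {α : ℂ | α.re ≤ Q ∧
      ((((Q : ℂ) - α) ^ 2 - 2 * (lam : ℂ)) ^ ((1 : ℂ) / 2)).re > ((Q : ℂ) - α).re - γ / 2}) :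
    IsConnected W ∧ W ⊆ {α : ℂ | α.re ≤ Q} ∧
      (∀ P : ℝ, (Q : ℂ) + (P : ℂ) * Complex.I ∈ W) ∧
      (∀ x : ℝ, x < Q - 2 * lam / γ - γ / 4 → (x : ℂ) ∈ W) := by
  have hg : 0 < γ / 2 := by positivity
  subst hW
  have hline : ∀ P : ℝ, (Q : ℂ) + (P : ℂ) * Complex.I ∈ {α : ℂ | α.re ≤ Q ∧
      ((((Q : ℂ) - α) ^ 2 - 2 * (lam : ℂ)) ^ ((1 : ℂ) / 2)).re
        > ((Q : ℂ) - α).re - γ / 2} := fun P => by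
    refine ⟨by simp, lt_of_lt_of_le ?_ (Complex.re_cpow_one_half_nonneg _)⟩
    simpa using hg
  refine ⟨isConnected_of_vertical_stable hline ?_ ?_, fun α hα => hα.1, hline, fun x hx => ?_⟩
  · rintro α ⟨hα, h⟩ t ht
    exact ⟨by simpa using hα, lt_re_sqrt_of_abs_im_le hg (by simp) (by simpa using ht) h⟩
  · rintro α ⟨hα, -⟩
    set K : ℝ := 2 * lam * (Q - α.re) ^ 2 with hK
    have hK0 : 0 ≤ K := by positivity
    refine ⟨(K + 1) / (γ / 2) ^ 2 + 1, fun t ht x hx => ?_⟩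
    rw [Set.uIcc_of_le hα] at hx
    refine ⟨by simpa using hx.2, lt_re_sqrt_of_large_im hlam hg ?_⟩
    have hre : ((Q : ℂ) - (x + t * Complex.I)).re = Q - x := by simp
    have him : ((Q : ℂ) - (x + t * Complex.I)).im = -t := by simp
    rw [hre, him, neg_sq, ← sq_abs t]
    have hq : 0 ≤ (K + 1) / (γ / 2) ^ 2 := by positivity
    have hKt : (K + 1) / (γ / 2) ^ 2 ≤ |t| ^ 2 := by nlinarith
    have hKt' := (div_le_iff₀ (by positivity)).1 hKt
    have hx' : 2 * lam * (Q - x) ^ 2 ≤ K :=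
      mul_le_mul_of_nonneg_left
        (pow_le_pow_left₀ (by linarith [hx.2]) (by linarith [hx.1]) 2) (by positivity)
    linarith
  · have hdiv : 0 ≤ 2 * lam / γ := by positivity
    refine ⟨by simp only [Complex.ofReal_re]; linarith, lt_re_sqrt_of_large_re hg ?_⟩
    have hre : ((Q : ℂ) - x).re = Q - x := by simp
    have hmul : 2 * lam / γ * γ = 2 * lam := div_mul_cancel₀ _ hγ0.ne'
    rw [hre]
    nlinarith [mul_lt_mul_of_pos_right hx hγ0]
end
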